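/- Let n, k be positive integers with 1 ≤ k < n and e = gcd(k, n), and suppose n/e is even, so n = 2m for an integer m with e dividing m. Then for u ∈ F_q^*: if u is not a (2^e+1)-th power of any element of F_q^*, then Σ_{x ∈ F_q} χ1(u·x^{2^k+1}) = (−1)^{m/e}·2^m; and if u = w^{2^e+1} for some w ∈ F_q^*, then Σ_{x ∈ F_q} χ1(u·x^{2^k+1}) = (−1)^{(m/e)+1}·2^{m+e}. -/

import Mathlib

/-- The absolute trace map `Tr : F → F_2`, viewed inside `F` (its values lie in `{0,1}`),
for a field `F` with `2^n` elements. -/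
def absTr (n : ℕ) {F : Type*} [Field F] (x : F) : F :=
  ∑ i ∈ Finset.range n, x ^ (2 ^ i)

/-- The canonical additive character `χ1(x) = (−1)^{Tr(x)} ∈ ℤ`. -/
def chi (n : ℕ) {F : Type*} [Field F] [DecidableEq F] (x : F) : ℤ :=
  if absTr n x = 0 then 1 else -1

section AbsTr

variable {n : ℕ} {F : Type*} [Field F]

theorem absTr_zero : absTr n (0 : F) = 0 := by
  unfold absTr
  exact Finset.sum_eq_zero fun i _ => zero_pow (by positivity)

theorem absTr_add [CharP F 2] (x y : F) : absTr n (x + y) = absTr n x + absTr n y := by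
  simp only [absTr, add_pow_char_pow, Finset.sum_add_distrib]

theorem absTr_sq (x : F) (hx : x ^ 2 ^ n = x) : absTr n (x ^ 2) = absTr n x := by
  have h := Finset.sum_range_succ (fun i => x ^ 2 ^ i) n
  rw [Finset.sum_range_succ', hx, pow_zero, pow_one] at h
  simpa only [absTr, ← pow_mul, ← pow_succ'] using add_right_cancel h

theorem absTr_pow_two_pow (hF : ∀ x : F, x ^ 2 ^ n = x) (x : F) (j : ℕ) :
    absTr n (x ^ 2 ^ j) = absTr n x := by
  induction j with
  | zero => simp
  | succ j ih => rw [pow_succ, pow_mul, absTr_sq _ (hF _), ih]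

theorem absTr_eq_zero_or_one [CharP F 2] (hF : ∀ x : F, x ^ 2 ^ n = x) (x : F) :
    absTr n x = 0 ∨ absTr n x = 1 := by
  have h : absTr n x ^ 2 = absTr n x := by
    conv_rhs => rw [← absTr_sq x (hF x)]
    simp only [absTr, sum_pow_char, ← pow_mul, mul_comm]
  have h' : absTr n x * (absTr n x - 1) = 0 := by linear_combination h
  rcases mul_eq_zero.1 h' with h | h
  · exact Or.inl h
  · exact Or.inr (sub_eq_zero.1 h)

theorem exists_absTr_ne_zero [Fintype F] (hn : 0 < n) (hcard : Fintype.card F = 2 ^ n) :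
    ∃ x : F, absTr n x ≠ 0 := by
  classical
  by_contra! h
  let p : Polynomial F := ∑ i ∈ Finset.range n, Polynomial.X ^ 2 ^ i
  have hcoeff : p.coeff 1 = 1 := by
    simp only [p, Polynomial.finsetSum_coeff, Polynomial.coeff_X_pow]
    rw [Finset.sum_eq_single 0]
    · simp
    · intro i _ hi
      rw [if_neg]
      exact (Nat.one_lt_two_pow hi).ne
    · simp [hn.ne']
  have hp : p ≠ 0 := by
    intro h0
    simp [h0] at hcoeff
  have hdeg : p.natDegree ≤ 2 ^ (n - 1) := by
    refine Polynomial.natDegree_sum_le_of_forall_le _ _ fun i hi => ?_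
    rw [Polynomial.natDegree_X_pow]
    have := Finset.mem_range.1 hi
    exact Nat.pow_le_pow_right two_pos (by omega)
  have hle : Fintype.card F ≤ p.natDegree := by
    rw [← Finset.card_univ]
    refine Polynomial.card_le_degree_of_subset_roots (fun x _ => ?_)
    rw [Polynomial.mem_roots hp, Polynomial.IsRoot]
    simpa [p, Polynomial.eval_finsetSum, absTr] using h x
  have : 2 ^ (n - 1) < 2 ^ n := Nat.pow_lt_pow_right one_lt_two (by omega)
  omega

/-- The trace to `F_2` kills a subfield of even index. -/
theorem absTr_eq_zero_of_pow_eq_self [CharP F 2] {m : ℕ} (c : F) (hc : c ^ 2 ^ m = c) :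
    absTr (2 * m) c = 0 := by
  have h : ∀ i, c ^ 2 ^ (m + i) = c ^ 2 ^ i := fun i => by rw [pow_add, pow_mul, hc]
  simp only [absTr, two_mul, Finset.sum_range_add, h]
  exact CharTwo.add_self_eq_zero _

end AbsTr

section Chi

variable {n : ℕ} {F : Type*} [Field F] [DecidableEq F]

theorem chi_zero : chi n (0 : F) = 1 := by
  simp [chi, absTr_zero]

theorem chi_add [CharP F 2] (hF : ∀ x : F, x ^ 2 ^ n = x) (x y : F) :
    chi n (x + y) = chi n x * chi n y := by
  simp only [chi, absTr_add]
  rcases absTr_eq_zero_or_one hF x with hx | hx <;>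
    rcases absTr_eq_zero_or_one hF y with hy | hy <;>
    simp [hx, hy, CharTwo.add_self_eq_zero]

theorem chi_pow_two_pow (hF : ∀ x : F, x ^ 2 ^ n = x) (x : F) (j : ℕ) :
    chi n (x ^ 2 ^ j) = chi n x := by
  simp only [chi, absTr_pow_two_pow hF]

theorem sum_chi_mul [CharP F 2] [Fintype F] (hn : 0 < n) (hcard : Fintype.card F = 2 ^ n) (a : F) :
    ∑ x : F, chi n (x * a) = if a = 0 then 2 ^ n else 0 := by
  have hF : ∀ x : F, x ^ 2 ^ n = x := fun x => hcard ▸ FiniteField.pow_card x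
  split_ifs with ha
  · simp [ha, chi_zero, hcard]
  · obtain ⟨y, hy⟩ := exists_absTr_ne_zero (F := F) hn hcard
    have hy' : chi n y = -1 := by simp [chi, hy]
    have h := Equiv.sum_comp (Equiv.addRight (y / a)) (fun x => chi n (x * a))
    simp only [Equiv.coe_addRight, add_mul, div_mul_cancel₀ _ ha, chi_add hF, hy',
      ← Finset.sum_mul] at h
    linarith

/-- The square of a Weil sum of Gold type counts roots of the linearized polynomial
`u z + (u z ^ (2 ^ k)) ^ (2 ^ k)`. -/
theorem sq_sum_chi_gold [CharP F 2] [Fintype F] (hn : 0 < n) (hcard : Fintype.card F = 2 ^ n)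
    (k : ℕ) (u : F) :
    (∑ x : F, chi n (u * x ^ (2 ^ k + 1))) ^ 2 =
      2 ^ n * ∑ z : F with u * z + (u * z ^ 2 ^ k) ^ 2 ^ k = 0, chi n (u * z ^ (2 ^ k + 1)) := by
  have hF : ∀ x : F, x ^ 2 ^ n = x := fun x => hcard ▸ FiniteField.pow_card x
  have hshift : ∀ x : F, ∑ y : F, chi n (u * y ^ (2 ^ k + 1)) =
      ∑ z : F, chi n (u * (x + z) ^ (2 ^ k + 1)) := fun x =>
    (Equiv.sum_comp (Equiv.addLeft x) fun y => chi n (u * y ^ (2 ^ k + 1))).symm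
  have hterm : ∀ x z : F, chi n (u * x ^ (2 ^ k + 1)) * chi n (u * (x + z) ^ (2 ^ k + 1)) =
      chi n (u * z ^ (2 ^ k + 1)) * chi n (x ^ 2 ^ k * (u * z + (u * z ^ 2 ^ k) ^ 2 ^ k)) := by
    intro x z
    have h1 : chi n (x ^ 2 ^ k * (u * z + (u * z ^ 2 ^ k) ^ 2 ^ k)) =
        chi n (x ^ 2 ^ k * (u * z) + x * (u * z ^ 2 ^ k)) := by
      rw [mul_add, chi_add hF, chi_add hF, ← mul_pow, chi_pow_two_pow hF]
    rw [h1, ← chi_add hF, ← chi_add hF]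
    congr 1
    have h2 : (x + z) ^ (2 ^ k + 1) = (x ^ 2 ^ k + z ^ 2 ^ k) * (x + z) := by
      rw [pow_succ, add_pow_char_pow]
    rw [h2]
    linear_combination u * x ^ 2 ^ k * x * CharTwo.two_eq_zero (R := F)
  have hbij : Function.Bijective fun x : F => x ^ 2 ^ k := bijective_iterateFrobenius F 2 k
  calc (∑ x : F, chi n (u * x ^ (2 ^ k + 1))) ^ 2
      = ∑ x : F, ∑ z : F, chi n (u * x ^ (2 ^ k + 1)) * chi n (u * (x + z) ^ (2 ^ k + 1)) := by
        rw [sq, Finset.sum_mul]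
        refine Finset.sum_congr rfl fun x _ => ?_
        rw [hshift x, Finset.mul_sum]
    _ = ∑ z : F, chi n (u * z ^ (2 ^ k + 1)) *
          ∑ x : F, chi n (x * (u * z + (u * z ^ 2 ^ k) ^ 2 ^ k)) := by
        rw [Finset.sum_comm]
        refine Finset.sum_congr rfl fun z _ => ?_
        simp only [hterm, ← Finset.mul_sum]
        rw [Fintype.sum_bijective _ hbij _
          (fun x => chi n (x * (u * z + (u * z ^ 2 ^ k) ^ 2 ^ k))) fun _ => rfl]
    _ = _ := by
        simp only [sum_chi_mul hn hcard, mul_ite, mul_zero]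
        rw [← Finset.sum_filter, ← Finset.sum_mul, mul_comm]

end Chi

section FiniteField

variable {F : Type*} [Field F] [Fintype F]

theorem FiniteField.exists_pow_eq_pow_gcd (K : ℕ) {w : F} (hw : w ≠ 0) :
    ∃ t : F, t ≠ 0 ∧ t ^ K = w ^ Nat.gcd K (Fintype.card F - 1) := by
  refine ⟨w ^ Nat.gcdA K (Fintype.card F - 1), zpow_ne_zero _ hw, ?_⟩
  rw [← zpow_natCast w, Nat.gcd_eq_gcd_ab, zpow_add₀ hw, zpow_mul w (Fintype.card F - 1 : ℕ),
    zpow_natCast w, FiniteField.pow_card_sub_one_eq_one w hw, one_zpow, mul_one,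
    ← zpow_natCast, ← zpow_mul, mul_comm]

variable [DecidableEq F]

theorem FiniteField.sum_eq_add_sum_units {M : Type*} [AddCommMonoid M] (f : F → M) :
    ∑ x : F, f x = f 0 + ∑ x : Fˣ, f x := by
  rw [Fintype.sum_eq_add_sum_compl 0]
  congr 1
  refine (Finset.sum_bij (fun (x : Fˣ) _ => (x : F)) ?_ ?_ ?_ ?_).symm
  · simp
  · intro a _ b _ h
    exact Units.ext h
  · intro b hb
    exact ⟨Units.mk0 b (by simpa using hb), by simp⟩
  · simp

theorem FiniteField.gcd_dvd_sum_pow_sub (K : ℕ) (hK : K ≠ 0) (f : F → ℤ) :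
    ((Nat.gcd K (Fintype.card F - 1) : ℕ) : ℤ) ∣ ∑ x : F, f (x ^ K) - f 0 := by
  rw [FiniteField.sum_eq_add_sum_units, zero_pow hK, add_sub_cancel_left,
    ← Finset.sum_fiberwise (s := Finset.univ) (g := fun x : Fˣ => x ^ K)]
  refine Finset.dvd_sum fun y _ => ?_
  have hconst : ∑ x : Fˣ with x ^ K = y, f ((x : F) ^ K) =
      (Finset.card {x : Fˣ | x ^ K = y} : ℤ) * f y := by
    rw [Finset.sum_congr rfl (g := fun _ => f y), Finset.sum_const, nsmul_eq_mul]
    intro x hx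
    rw [← (Finset.mem_filter.1 hx).2, Units.val_pow_eq_pow_val]
  rw [hconst]
  refine Dvd.dvd.mul_right ?_ _
  by_cases hy : ∃ x : Fˣ, x ^ K = y
  · have h := MonoidHom.card_fiber_eq_of_mem_range (powMonoidHom K : Fˣ →* Fˣ)
      (x := y) (y := 1) hy ⟨1, one_pow K⟩
    have h' := IsCyclic.card_powMonoidHom_ker Fˣ K
    rw [Nat.card_eq_fintype_card (α := Fˣ), Fintype.card_units, Nat.gcd_comm] at h'
    simp only [powMonoidHom_apply] at h
    rw [h, ← h', Nat.card_eq_fintype_card, ← Fintype.card_subtype]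
    exact dvd_of_eq (congrArg _ (Fintype.card_congr (Equiv.subtypeEquivRight fun _ => Iff.rfl)))
  · rw [Finset.filter_eq_empty_iff.2 fun x _ hx => hy ⟨x, hx⟩]
    simp

theorem FiniteField.card_pow_eq_one (K : ℕ) (hK : K ≠ 0) :
    Finset.card {x : F | x ^ K = 1} = Nat.gcd K (Fintype.card F - 1) := by
  have h' := IsCyclic.card_powMonoidHom_ker Fˣ K
  rw [Nat.card_eq_fintype_card (α := Fˣ), Fintype.card_units, Nat.gcd_comm] at h'
  rw [← h', Nat.card_eq_fintype_card, Fintype.card_subtype]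
  refine (Finset.card_bij (fun (x : Fˣ) _ => (x : F)) ?_ ?_ ?_).symm
  · intro a ha
    simpa [MonoidHom.mem_ker, Units.ext_iff] using ha
  · intro a _ b _ h
    exact Units.ext h
  · intro b hb
    have hb' : b ^ K = 1 := by simpa using hb
    have hb0 : b ≠ 0 := by
      rintro rfl
      simp [hK] at hb'
    exact ⟨Units.mk0 b hb0, by simpa [MonoidHom.mem_ker, Units.ext_iff] using hb', by simp⟩

end FiniteField

section Arithmetic

variable {n k e m : ℕ}

theorem gcd_two_mul_eq (he : e = Nat.gcd k n) (hm : n = 2 * m) (hem : e ∣ m) :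
    Nat.gcd (2 * k) n = 2 * e := by
  rw [hm, Nat.gcd_mul_left]
  congr 1
  apply Nat.dvd_antisymm
  · rw [he]
    exact Nat.dvd_gcd (Nat.gcd_dvd_left _ _)
      (hm ▸ (Nat.gcd_dvd_right _ _).mul_left 2)
  · exact Nat.dvd_gcd (he ▸ Nat.gcd_dvd_left _ _) hem

theorem two_pow_add_one_mul_sub_one (a : ℕ) : (2 ^ a + 1) * (2 ^ a - 1) = 2 ^ (2 * a) - 1 := by
  rw [mul_comm 2 a, pow_mul, ← Nat.sq_sub_sq, one_pow]

theorem gcd_two_pow_add_one (hk1 : 1 ≤ k) (he : e = Nat.gcd k n) (heven : Even (n / e))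
    (hm : n = 2 * m) (hem : e ∣ m) :
    Nat.gcd (2 ^ k + 1) (2 ^ n - 1) = 2 ^ e + 1 := by
  have he0 : 0 < e := he ▸ Nat.gcd_pos_of_pos_left _ hk1
  have hek : e ∣ k := he ▸ Nat.gcd_dvd_left _ _
  apply Nat.dvd_antisymm
  · have h1 : Nat.gcd (2 ^ k + 1) (2 ^ n - 1) ∣ (2 ^ e + 1) * (2 ^ e - 1) := by
      rw [two_pow_add_one_mul_sub_one, ← gcd_two_mul_eq he hm hem,
        ← Nat.pow_sub_one_gcd_pow_sub_one]
      exact Nat.gcd_dvd_gcd_of_dvd_left _ (Dvd.intro _ (two_pow_add_one_mul_sub_one k))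
    have h2 : Nat.Coprime (2 ^ k + 1) (2 ^ k - 1) := by
      have hpos : 1 ≤ 2 ^ k := Nat.one_le_two_pow
      have h3 : 2 ^ k + 1 = (2 ^ k - 1) + 2 := by omega
      rw [h3, Nat.coprime_self_add_left, Nat.coprime_two_left, Nat.odd_sub hpos]
      simp [Nat.even_pow, parity_simps]
      omega
    exact ((h2.coprime_dvd_left (Nat.gcd_dvd_left _ _)).coprime_dvd_right
      (Nat.pow_sub_one_dvd_pow_sub_one 2 hek)).dvd_of_dvd_mul_right h1
  · apply Nat.dvd_gcd
    · have hodd : Odd (k / e) := by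
        have hco : Nat.Coprime (k / e) (n / e) := by
          subst he
          exact Nat.coprime_div_gcd_div_gcd he0
        rw [← Nat.not_even_iff_odd]
        intro h
        have := Nat.dvd_gcd h.two_dvd heven.two_dvd
        rw [hco] at this
        omega
      have := Odd.nat_add_dvd_pow_add_pow (2 ^ e) 1 hodd
      rwa [← pow_mul, Nat.mul_div_cancel' hek, one_pow] at this
    · refine (Dvd.intro _ (two_pow_add_one_mul_sub_one e)).trans ?_
      exact Nat.pow_sub_one_dvd_pow_sub_one 2 (hm ▸ Nat.mul_dvd_mul_left 2 hem)

/-- The sign of an integer of known absolute value is determined by its residue modulo `d ≥ 3`. -/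
theorem eq_neg_one_pow_mul_of_sq_eq {S A : ℤ} {d r : ℕ} (hd : 3 ≤ d) (hsq : S ^ 2 = A ^ 2)
    (hS : (d : ℤ) ∣ S - 1) (hA : (d : ℤ) ∣ A - (-1) ^ r) : S = (-1) ^ r * A := by
  have hsgn : ((-1 : ℤ) ^ r) * (-1) ^ r = 1 := by
    rw [← mul_pow]
    simp
  have hne : ¬ (d : ℤ) ∣ 2 := fun h => by
    have := Int.le_of_dvd two_pos h
    omega
  have hA' : (d : ℤ) ∣ (-1) ^ r * A - 1 := by
    have := hA.mul_left ((-1) ^ r)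
    rwa [mul_sub, hsgn] at this
  have hsq' : S ^ 2 = ((-1) ^ r * A) ^ 2 := by
    rw [hsq]
    linear_combination (-A ^ 2) * hsgn
  rcases sq_eq_sq_iff_eq_or_eq_neg.1 hsq' with h | h
  · exact h
  · refine absurd ?_ hne
    have h2 : (2 : ℤ) = -((S - 1) + ((-1) ^ r * A - 1)) := by
      linear_combination h
    rw [h2]
    exact (hS.add hA').neg_right

theorem two_pow_add_one_dvd_two_pow_mul_sub (e r : ℕ) :
    ((2 ^ e + 1 : ℕ) : ℤ) ∣ 2 ^ (e * r) - (-1) ^ r := by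
  have := sub_dvd_pow_sub_pow ((2 : ℤ) ^ e) (-1) r
  rw [pow_mul]
  push_cast
  simpa using this

end Arithmetic

section GoldSum

variable {k e : ℕ} {F : Type*} [Field F]

theorem pow_eq_one_of_gold_root [CharP F 2] {u z : F} (hu : u ≠ 0) (hz : z ≠ 0)
    (h : u * z + (u * z ^ 2 ^ k) ^ 2 ^ k = 0) : (u * z ^ (2 ^ k + 1)) ^ (2 ^ k - 1) = 1 := by
  have hne : u * z ^ (2 ^ k + 1) ≠ 0 := mul_ne_zero hu (pow_ne_zero _ hz)
  have h' : (u * z ^ 2 ^ k) ^ 2 ^ k = u * z := (CharTwo.add_eq_zero.1 h).symm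
  apply mul_right_cancel₀ hne
  rw [pow_sub_one_mul (by positivity), one_mul, pow_succ, ← mul_assoc, mul_pow, h']
  ring

theorem exists_pow_eq_of_pow_eq_one {c : F} (he : 0 < e) (hc : c ^ (2 ^ e - 1) = 1) :
    ∃ v : F, v ^ (2 ^ e + 1) = c := by
  have hc' : c ^ 2 ^ e = c := by
    rw [← pow_sub_one_mul (by positivity) c, hc, one_mul]
  refine ⟨c ^ 2 ^ (e - 1), ?_⟩
  rw [← pow_mul, mul_comm, pow_mul, pow_succ, hc', ← sq, ← pow_mul, ← pow_succ',
    Nat.sub_add_cancel he, hc']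

end GoldSum

/-- If `n/e` is even (`e = gcd(k,n)`), with `n = 2m` and `e ∣ m`, then for nonzero `u`:
`Σ_x χ1(u x^{2^k+1}) = (−1)^{m/e} 2^m` if `u` is not a `(2^e+1)`-th power, and
`= (−1)^{m/e+1} 2^{m+e}` if it is. -/
theorem weil_sum_gold_no_linear_term_even (n k e m : ℕ) (hk1 : 1 ≤ k) (hkn : k < n)
    (he : e = Nat.gcd k n) (heven : Even (n / e)) (hm : n = 2 * m) (hem : e ∣ m)
    {F : Type*} [Field F] [Fintype F] [DecidableEq F] [CharP F 2]
    (hcard : Fintype.card F = 2 ^ n)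
    (u : F) (hu : u ≠ 0) :
    ((¬ ∃ w : F, w ≠ 0 ∧ w ^ (2 ^ e + 1) = u) →
        ∑ x : F, chi n (u * x ^ (2 ^ k + 1)) = (-1) ^ (m / e) * 2 ^ m) ∧
    ((∃ w : F, w ≠ 0 ∧ w ^ (2 ^ e + 1) = u) →
        ∑ x : F, chi n (u * x ^ (2 ^ k + 1)) = (-1) ^ (m / e + 1) * 2 ^ (m + e)) := by
  have he0 : 0 < e := he ▸ Nat.gcd_pos_of_pos_left _ hk1
  have hn : 0 < n := by omega
  have hgcd := gcd_two_pow_add_one hk1 he heven hm hem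
  have hd : 3 ≤ 2 ^ e + 1 := by
    have := Nat.one_lt_two_pow he0.ne'
    omega
  have hgcd1 : ∀ c : F, c ≠ 0 → c ^ (2 ^ k - 1) = 1 → c ^ (2 ^ e - 1) = 1 := by
    intro c hc0 hc
    rw [he, ← Nat.pow_sub_one_gcd_pow_sub_one, pow_gcd_eq_one]
    exact ⟨hc, hcard ▸ FiniteField.pow_card_sub_one_eq_one c hc0⟩
  have hmod : ∀ a : F,
      ((2 ^ e + 1 : ℕ) : ℤ) ∣ ∑ x : F, chi n (a * x ^ (2 ^ k + 1)) - 1 := by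
    intro a
    have := FiniteField.gcd_dvd_sum_pow_sub (2 ^ k + 1) (Nat.succ_ne_zero _)
      fun x : F => chi n (a * x)
    rwa [hcard, hgcd, mul_zero, chi_zero] at this
  constructor
  · intro hnot
    refine eq_neg_one_pow_mul_of_sq_eq hd ?_ (hmod u) ?_
    · rw [sq_sum_chi_gold hn hcard, ← pow_mul, mul_comm m 2, ← hm]
      have hroots : Finset.filter (fun z : F => u * z + (u * z ^ 2 ^ k) ^ 2 ^ k = 0) Finset.univ
          = {0} := by
        ext z
        simp only [Finset.mem_filter, Finset.mem_univ, true_and, Finset.mem_singleton]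
        refine ⟨fun hz => ?_, fun hz => by simp [hz]⟩
        by_contra hz0
        have hne : u * z ^ (2 ^ k + 1) ≠ 0 := mul_ne_zero hu (pow_ne_zero _ hz0)
        obtain ⟨v, hv⟩ := exists_pow_eq_of_pow_eq_one he0
          (hgcd1 _ hne (pow_eq_one_of_gold_root hu hz0 hz))
        obtain ⟨r, hr⟩ : 2 ^ e + 1 ∣ 2 ^ k + 1 := hgcd ▸ Nat.gcd_dvd_left _ _
        have hv0 : v ≠ 0 := by
          rintro rfl
          exact hne (by rw [← hv, zero_pow (Nat.succ_ne_zero _)])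
        refine hnot ⟨v / z ^ r, div_ne_zero hv0 (pow_ne_zero _ hz0), ?_⟩
        rw [div_pow, hv, ← pow_mul, mul_comm r, ← hr, mul_div_cancel_right₀]
        exact pow_ne_zero _ hz0
      simp [hroots, chi_zero]
    · have := two_pow_add_one_dvd_two_pow_mul_sub e (m / e)
      rwa [Nat.mul_div_cancel' hem] at this
  · rintro ⟨w, hw, rfl⟩
    obtain ⟨t, ht, htw⟩ := FiniteField.exists_pow_eq_pow_gcd (2 ^ k + 1) hw
    rw [hcard, hgcd] at htw
    have hone : ∑ x : F, chi n (w ^ (2 ^ e + 1) * x ^ (2 ^ k + 1)) =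
        ∑ x : F, chi n (1 * x ^ (2 ^ k + 1)) :=
      Fintype.sum_bijective (fun x => t * x) (mulLeft_bijective₀ t ht) _ _ fun x => by
        rw [← htw, ← mul_pow, one_mul]
    rw [hone]
    refine eq_neg_one_pow_mul_of_sq_eq hd ?_ (hmod 1) ?_
    · rw [sq_sum_chi_gold hn hcard]
      have hval : ∀ z ∈ Finset.filter (fun z : F => 1 * z + (1 * z ^ 2 ^ k) ^ 2 ^ k = 0)
          Finset.univ, chi n (1 * z ^ (2 ^ k + 1)) = 1 := by
        intro z hz
        rcases eq_or_ne z 0 with rfl | hz0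
        · simp [chi_zero]
        · have hne : 1 * z ^ (2 ^ k + 1) ≠ 0 := mul_ne_zero one_ne_zero (pow_ne_zero _ hz0)
          have h1 := hgcd1 _ hne
            (pow_eq_one_of_gold_root one_ne_zero hz0 (Finset.mem_filter.1 hz).2)
          obtain ⟨s, hs⟩ := Nat.pow_sub_one_dvd_pow_sub_one 2 hem
          rw [chi, if_pos]
          rw [hm]
          apply absTr_eq_zero_of_pow_eq_self
          rw [← pow_sub_one_mul (by positivity) (1 * z ^ (2 ^ k + 1)), hs, pow_mul, h1, one_pow,
            one_mul]
      have hroots : Finset.filter (fun z : F => 1 * z + (1 * z ^ 2 ^ k) ^ 2 ^ k = 0) Finset.univ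
          = insert 0 (Finset.filter (fun z : F => z ^ (2 ^ (2 * k) - 1) = 1) Finset.univ) := by
        ext z
        simp only [Finset.mem_filter, Finset.mem_univ, true_and, Finset.mem_insert, one_mul,
          CharTwo.add_eq_zero, ← pow_mul, ← pow_add, ← two_mul]
        rcases eq_or_ne z 0 with rfl | hz0
        · simp
        · rw [← pow_sub_one_mul (n := 2 ^ (2 * k)) (by positivity) z, eq_comm,
            mul_eq_right₀ hz0]
          simp [hz0]
      have hK : 2 ^ (2 * k) - 1 ≠ 0 := by
        have := Nat.one_lt_two_pow (n := 2 * k) (by omega)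
        omega
      have hcardroots : Finset.card (Finset.filter
          (fun z : F => 1 * z + (1 * z ^ 2 ^ k) ^ 2 ^ k = 0) Finset.univ) = 2 ^ (2 * e) := by
        rw [hroots, Finset.card_insert_of_notMem (by simp [hK]),
          FiniteField.card_pow_eq_one _ hK, hcard, Nat.pow_sub_one_gcd_pow_sub_one,
          gcd_two_mul_eq he hm hem, Nat.sub_add_cancel Nat.one_le_two_pow]
      rw [Finset.sum_congr rfl hval, Finset.sum_const, hcardroots, hm]
      ring
    · have := two_pow_add_one_dvd_two_pow_mul_sub e (m / e + 1)
      rwa [mul_add, Nat.mul_div_cancel' hem, mul_one] at this
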